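/- For every integer n ≥ 2 and every integer k with 1 ≤ k ≤ n, R(n,k) ≥ 0. -/

import Mathlib

/-- `R(n,k) = k/n - √(k(k-1)/(n(n-1))) - 1/(2n) + k/(2n²)` -/
noncomputable def R (n k : ℕ) : ℝ :=
  (k : ℝ) / n - Real.sqrt ((k * (k - 1)) / (n * (n - 1))) - 1 / (2 * n) + k / (2 * n ^ 2)

theorem stmt_1 (n k : ℕ) (hn : 2 ≤ n) (hk1 : 1 ≤ k) (hkn : k ≤ n) : 0 ≤ R n k := by
  unfold R
  have h1 : (2 : ℝ) ≤ n := by exact_mod_cast hn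
  have h2 : (1 : ℝ) ≤ k := by exact_mod_cast hk1
  have h3 : (k : ℝ) ≤ n := by exact_mod_cast hkn
  generalize (n : ℝ) = x at *
  generalize (k : ℝ) = y at *
  have hx : 0 < x := by linarith
  have hx1 : 0 < x - 1 := by linarith
  have key : Real.sqrt ((y * (y - 1)) / (x * (x - 1))) ≤ (2 * y * x - x + y) / (2 * x ^ 2) := by
    apply Real.sqrt_le_iff.mpr
    constructor
    · apply div_nonneg _ (by positivity)
      nlinarith
    · have e : ((2 * y * x - x + y) / (2 * x ^ 2)) ^ 2 - (y * (y - 1)) / (x * (x - 1))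
          = (x - y) * ((3 * x + 1) * y + x * (x - 1)) / (4 * x ^ 4 * (x - 1)) := by
        have := hx1.ne'
        field_simp
        ring
      have : 0 ≤ (x - y) * ((3 * x + 1) * y + x * (x - 1)) / (4 * x ^ 4 * (x - 1)) := by
        have : 0 ≤ x - y := by linarith
        have : 0 ≤ y := by linarith
        positivity
      linarith
  have e2 : (2 * y * x - x + y) / (2 * x ^ 2) = y / x - 1 / (2 * x) + y / (2 * x ^ 2) := by
    field_simp
  linarith
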